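/- Let k ≥ 2 be an integer and η > 0. There is a constant C(k,η) > 0 such that for all real X ≥ 1, L ≥ X and every finite set A of positive integers with A ⊆ [X, 2X], one has ∑_{1 ≤ l ≤ L} d_A(l)^k ≤ C(k,η) · L^{1+(k-1)η} · X^{-1} · |A|, where d_A(l) = #{a ∈ A : a | l}. -/

import Mathlib

open Finset

/-- For every `η > 0`, the quotient `(v + 1) / p ^ (η * v)` is bounded uniformly in `p ≥ 2`
and `v`. -/
lemma add_one_le_const_mul_rpow {η : ℝ} (hη : 0 < η) {p : ℕ} (hp : 2 ≤ p) (v : ℕ) :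
    (v + 1 : ℝ) ≤ (1 + (η * Real.log 2)⁻¹) * ((p : ℝ) ^ v) ^ η := by
  have hlog : 0 < η * Real.log 2 := mul_pos hη (Real.log_pos one_lt_two)
  have hp' : (2 : ℝ) ≤ p := by exact_mod_cast hp
  have h2 : η * Real.log 2 * v + 1 ≤ ((p : ℝ) ^ v) ^ η :=
    calc η * Real.log 2 * v + 1 ≤ Real.exp (η * Real.log 2 * v) := Real.add_one_le_exp _
      _ = ((2 : ℝ) ^ v) ^ η := by
        rw [Real.rpow_def_of_pos (by positivity), Real.log_pow]
        ring_nf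
      _ ≤ ((p : ℝ) ^ v) ^ η := by gcongr
  calc (v + 1 : ℝ) ≤ (1 + (η * Real.log 2)⁻¹) * (η * Real.log 2 * v + 1) := by
        have h : (η * Real.log 2)⁻¹ * (η * Real.log 2 * v) = v := by field_simp
        have h3 : 0 ≤ η * Real.log 2 * v := by positivity
        have h4 : 0 ≤ (η * Real.log 2)⁻¹ := by positivity
        linarith
    _ ≤ _ := by gcongr

/-- If `p ^ η ≥ 2`, then `v + 1 ≤ p ^ (η * v)`. -/
lemma add_one_le_rpow_of_two_le {η : ℝ} {p : ℕ} (hp : 2 ≤ (p : ℝ) ^ η) (v : ℕ) :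
    (v + 1 : ℝ) ≤ ((p : ℝ) ^ v) ^ η :=
  calc (v + 1 : ℝ) ≤ 2 ^ v := by exact_mod_cast Nat.succ_le_of_lt v.lt_two_pow_self
    _ ≤ ((p : ℝ) ^ η) ^ v := by gcongr
    _ = ((p : ℝ) ^ v) ^ η := (Real.rpow_pow_comm p.cast_nonneg η v)

/-- The divisor bound: `n` has `O(n ^ η)` divisors. -/
lemma exists_card_divisors_le_rpow {η : ℝ} (hη : 0 < η) :
    ∃ C : ℝ, 0 < C ∧ ∀ n : ℕ, (n.divisors.card : ℝ) ≤ C * (n : ℝ) ^ η := by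
  have hlog : 0 < η * Real.log 2 := mul_pos hη (Real.log_pos one_lt_two)
  obtain ⟨N, hN⟩ := exists_nat_ge ((2 : ℝ) ^ η⁻¹)
  set M : ℝ := 1 + (η * Real.log 2)⁻¹
  have hM1 : 1 ≤ M := by
    have : 0 ≤ (η * Real.log 2)⁻¹ := by positivity
    linarith
  refine ⟨M ^ N, by positivity, fun n => ?_⟩
  rcases eq_or_ne n 0 with rfl | hn
  · simpa using by positivity
  have hprod : (n : ℝ) ^ η = ∏ p ∈ n.primeFactors, ((p : ℝ) ^ n.factorization p) ^ η := by
    rw [Real.finsetProd_rpow _ _ (fun _ _ => by positivity)]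
    congr 1
    exact_mod_cast (Nat.prod_factorization_pow_eq_self hn).symm
  have hconst : ∏ p ∈ n.primeFactors, (if p < N then M else 1) ≤ M ^ N := by
    rw [prod_ite, prod_const, prod_const_one, mul_one]
    refine pow_le_pow_right₀ hM1 ?_
    calc _ ≤ (range N).card := card_le_card fun p hp => by
          simpa using (mem_filter.mp hp).2
      _ = N := card_range N
  calc (n.divisors.card : ℝ) = ∏ p ∈ n.primeFactors, (n.factorization p + 1 : ℝ) := by
        rw [Nat.card_divisors hn]; push_cast; rfl
    _ ≤ ∏ p ∈ n.primeFactors,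
          ((if p < N then M else 1) * ((p : ℝ) ^ n.factorization p) ^ η) := by
        refine prod_le_prod (fun _ _ => by positivity) fun p hp => ?_
        split_ifs with h
        · exact add_one_le_const_mul_rpow hη (Nat.prime_of_mem_primeFactors hp).two_le _
        · rw [one_mul]
          refine add_one_le_rpow_of_two_le ?_ _
          have hNp : (N : ℝ) ≤ p := by exact_mod_cast not_lt.mp h
          calc (2 : ℝ) = ((2 : ℝ) ^ η⁻¹) ^ η := (Real.rpow_inv_rpow two_pos.le hη.ne').symm
            _ ≤ (p : ℝ) ^ η := by gcongr; exact hN.trans hNp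
    _ ≤ M ^ N * (n : ℝ) ^ η := by
        rw [prod_mul_distrib, ← hprod]
        gcongr

/-- The first moment of `l ↦ #{a ∈ A : a ∣ l}` over `l ≤ L`, for `A` bounded below by `X`. -/
lemma sum_card_filter_dvd_le {X L : ℝ} (hX : 0 < X) (hL : 0 ≤ L) {A : Finset ℕ}
    (hA : ∀ a ∈ A, X ≤ (a : ℝ)) :
    ∑ l ∈ Icc 1 ⌊L⌋₊, ((A.filter (fun a => a ∣ l)).card : ℝ) ≤ L * X⁻¹ * A.card := by
  have hswap : ∑ l ∈ Icc 1 ⌊L⌋₊, (A.filter (fun a => a ∣ l)).card = ∑ a ∈ A, ⌊L⌋₊ / a := by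
    simp_rw [card_filter]
    rw [sum_comm]
    refine sum_congr rfl fun a _ => ?_
    rw [← card_filter, ← Nat.Ioc_filter_dvd_card_eq_div]
    rfl
  calc ∑ l ∈ Icc 1 ⌊L⌋₊, ((A.filter (fun a => a ∣ l)).card : ℝ)
      = ∑ a ∈ A, ((⌊L⌋₊ / a : ℕ) : ℝ) := by exact_mod_cast hswap
    _ ≤ ∑ _a ∈ A, L * X⁻¹ := by
        refine sum_le_sum fun a ha => ?_
        calc ((⌊L⌋₊ / a : ℕ) : ℝ) ≤ (⌊L⌋₊ : ℝ) / a := Nat.cast_div_le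
          _ ≤ L / X := div_le_div₀ hL (Nat.floor_le hL) hX (hA a ha)
          _ = L * X⁻¹ := div_eq_mul_inv _ _
    _ = L * X⁻¹ * A.card := by rw [sum_const, nsmul_eq_mul, mul_comm]

theorem lcm_moment_bound (k : ℕ) (hk : 2 ≤ k) (η : ℝ) (hη : 0 < η) :
    ∃ C : ℝ, 0 < C ∧
      ∀ (X L : ℝ), 1 ≤ X → X ≤ L → ∀ A : Finset ℕ,
        (∀ a ∈ A, 0 < a) →
        (∀ a ∈ A, X ≤ (a : ℝ) ∧ (a : ℝ) ≤ 2 * X) →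
        ∑ l ∈ Finset.Icc 1 ⌊L⌋₊, ((A.filter (fun a => a ∣ l)).card : ℝ) ^ k ≤
          C * L ^ (1 + ((k : ℝ) - 1) * η) * X⁻¹ * (A.card : ℝ) := by
  obtain ⟨C, hC, hdiv⟩ := exists_card_divisors_le_rpow hη
  obtain ⟨m, rfl⟩ : ∃ m, k = m + 1 := ⟨k - 1, by omega⟩
  refine ⟨C ^ m, by positivity, fun X L hX hXL A _ hA => ?_⟩
  have hX0 : 0 < X := one_pos.trans_le hX
  have hL0 : 0 < L := hX0.trans_le hXL
  have hpt : ∀ l ∈ Icc 1 ⌊L⌋₊, ((A.filter (fun a => a ∣ l)).card : ℝ) ≤ C * L ^ η := by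
    intro l hl
    obtain ⟨hl1, hlL⟩ := mem_Icc.mp hl
    have hlL' : (l : ℝ) ≤ L := (Nat.le_floor_iff hL0.le).mp hlL
    calc ((A.filter (fun a => a ∣ l)).card : ℝ) ≤ l.divisors.card := by
          refine Nat.cast_le.mpr (card_le_card fun a ha => ?_)
          exact Nat.mem_divisors.mpr ⟨(mem_filter.mp ha).2, by omega⟩
      _ ≤ C * (l : ℝ) ^ η := hdiv l
      _ ≤ C * L ^ η := by gcongr
  have hpow : L ^ (1 + (((m + 1 : ℕ) : ℝ) - 1) * η) = (L ^ η) ^ m * L := by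
    rw [Real.rpow_add hL0, Real.rpow_one, ← Real.rpow_mul_natCast hL0.le, mul_comm L]
    congr 2
    push_cast
    ring
  calc ∑ l ∈ Icc 1 ⌊L⌋₊, ((A.filter (fun a => a ∣ l)).card : ℝ) ^ (m + 1)
      ≤ ∑ l ∈ Icc 1 ⌊L⌋₊, (C * L ^ η) ^ m * ((A.filter (fun a => a ∣ l)).card : ℝ) := by
        refine sum_le_sum fun l hl => ?_
        rw [pow_succ]
        gcongr
        exact hpt l hl
    _ = (C * L ^ η) ^ m * ∑ l ∈ Icc 1 ⌊L⌋₊, ((A.filter (fun a => a ∣ l)).card : ℝ) :=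
        (mul_sum _ _ _).symm
    _ ≤ (C * L ^ η) ^ m * (L * X⁻¹ * A.card) := by
        gcongr
        exact sum_card_filter_dvd_le hX0 hL0.le fun a ha => (hA a ha).1
    _ = _ := by
        rw [hpow, mul_pow]
        ring
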